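/- Convergence of mirror-descent dynamics in nonatomic congestion games: consider a nonatomic congestion game of n players whose edge cost functions are nondecreasing (so the potential Φ is convex on 𝒦), and suppose Φ is λ-smooth with respect to differentiable strictly convex regularizers (R₁,…,R_n), with q = (q₁,…,q_n) a minimizer of Φ over 𝒦. Suppose each player i starts from an initial strategy x⁰_i ∈ 𝒦_i with B^{R_i}(q_i, x⁰_i) ≤ γ and updates x_i^{t+1} = argmin_{z∈𝒦_i} { η_i ⟨(c_s(x^t))_{s∈𝒮_i}, z⟩ + B^{R_i}(z, x_i^t) }, where η ≤ η_i ≤ 1/λ for some η > 0. Then for every ε ∈ (0,1) and every integer t ≥ nγ/(ηε), Φ(x^t) ≤ Φ(q) + ε. -/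

import Mathlib

open Finset MeasureTheory RealInnerProductSpace

/-- The load on edge `e` induced by the strategy profile `x`. -/
noncomputable def load {n : ℕ} {E : Type*} [Fintype E] [DecidableEq E]
    (S : Fin n → Finset (Finset E)) (x : Fin n → EuclideanSpace ℝ (Finset E)) (e : E) : ℝ :=
  ∑ i, ∑ s ∈ (S i).filter (fun s => e ∈ s), x i s

/-- The cost of a path `s`: `c_s(x) = Σ_{e∈s} c_e(ℓ_e(x))`. -/
noncomputable def pathCost {n : ℕ} {E : Type*} [Fintype E] [DecidableEq E]
    (S : Fin n → Finset (Finset E)) (c : E → ℝ → ℝ)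
    (x : Fin n → EuclideanSpace ℝ (Finset E)) (s : Finset E) : ℝ :=
  ∑ e ∈ s, c e (load S x e)

/-- The potential function `Φ(x) = Σ_{e∈E} ∫_0^{ℓ_e(x)} c_e(y) dy`. -/
noncomputable def potential {n : ℕ} {E : Type*} [Fintype E] [DecidableEq E]
    (S : Fin n → Finset (Finset E)) (c : E → ℝ → ℝ)
    (x : Fin n → EuclideanSpace ℝ (Finset E)) : ℝ :=
  ∑ e : E, ∫ y in (0:ℝ)..(load S x e), c e y

/-- The feasible strategy set `𝒦_i` of player `i`. -/
def Ki {n : ℕ} {E : Type*} [Fintype E] [DecidableEq E]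
    (S : Fin n → Finset (Finset E)) (i : Fin n) : Set (EuclideanSpace ℝ (Finset E)) :=
  {z | (∀ s, 0 ≤ z s) ∧ (∀ s ∉ S i, z s = 0) ∧ ∑ s ∈ S i, z s = 1 / (n:ℝ)}

/-- The Bregman divergence generated by a regularizer `R` with gradient map `gR`. -/
noncomputable def breg {E : Type*} [Fintype E] [DecidableEq E]
    (R : EuclideanSpace ℝ (Finset E) → ℝ)
    (gR : EuclideanSpace ℝ (Finset E) → EuclideanSpace ℝ (Finset E))
    (u v : EuclideanSpace ℝ (Finset E)) : ℝ :=
  R u - R v - ⟪gR v, u - v⟫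

lemma cmd_dir {V : Type*} [NormedAddCommGroup V] [InnerProductSpace ℝ V] [CompleteSpace V]
    (f : V → ℝ) (g v d : V) (k : ℝ) (hf : HasGradientAt f g v)
    (h : ∀ t : ℝ, 0 < t → t ≤ 1 → f v + t * k ≤ f (v + t • d)) : k ≤ ⟪g, d⟫ := by
  have h1 : HasDerivAt (fun t : ℝ => f (v + t • d)) ⟪g, d⟫ 0 := by
    have h2 : HasDerivAt (fun t : ℝ => v + t • d) d 0 := by
      simpa using ((hasDerivAt_id (0:ℝ)).smul_const d).const_add v
    have h3 : HasFDerivAt f (InnerProductSpace.toDual ℝ V g) (v + (0:ℝ) • d) := by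
      simpa using hf.hasFDerivAt
    have h5 := h3.comp_hasDerivAt (0:ℝ) h2
    rw [InnerProductSpace.toDual_apply_apply] at h5
    exact h5
  have h4 := (hasDerivAt_iff_tendsto_slope.1 h1).mono_left
    (nhdsWithin_mono (0:ℝ) (s := Set.Ioi 0) (fun t ht => ne_of_gt ht))
  refine ge_of_tendsto h4 ?_
  filter_upwards [Ioc_mem_nhdsGT (zero_lt_one' ℝ)] with t ht
  have := h t ht.1 ht.2
  rw [slope_def_field, le_div_iff₀ (by linarith [ht.1])]
  simp only [zero_smul, add_zero, sub_zero]
  linarith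

lemma cmd_Ki_convex {n : ℕ} {E : Type*} [Fintype E] [DecidableEq E]
    (S : Fin n → Finset (Finset E)) (i : Fin n) : Convex ℝ (Ki S i) := by
  intro u hu v hv a b ha hb hab
  refine ⟨fun s => ?_, fun s hs => ?_, ?_⟩
  · have h1 := hu.1 s
    have h2 := hv.1 s
    simp only [PiLp.add_apply, PiLp.smul_apply, smul_eq_mul]
    positivity
  · simp [hu.2.1 s hs, hv.2.1 s hs]
  · simp only [PiLp.add_apply, PiLp.smul_apply, smul_eq_mul, Finset.sum_add_distrib,
      ← Finset.mul_sum, hu.2.2, hv.2.2]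
    rw [← add_mul, hab, one_mul]

lemma cmd_breg_nonneg {E : Type*} [Fintype E] [DecidableEq E]
    (K : Set (EuclideanSpace ℝ (Finset E)))
    (R : EuclideanSpace ℝ (Finset E) → ℝ)
    (gR : EuclideanSpace ℝ (Finset E) → EuclideanSpace ℝ (Finset E))
    (hc : ConvexOn ℝ K R) (u v : EuclideanSpace ℝ (Finset E)) (hu : u ∈ K) (hv : v ∈ K)
    (hg : HasGradientAt R (gR v) v) : 0 ≤ breg R gR u v := by
  have hg' : HasGradientAt (fun z => - R z) (-(gR v)) v := by
    have := hg.hasFDerivAt.neg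
    rw [hasGradientAt_iff_hasFDerivAt, map_neg]
    exact this
  have := cmd_dir (fun z => - R z) (-(gR v)) v (u - v) (R v - R u) hg' (by
    intro t ht0 ht1
    have h := hc.2 hv hu (sub_nonneg.2 ht1) ht0.le (by ring)
    have e : (1 - t) • v + t • u = v + t • (u - v) := by module
    rw [e] at h
    simp only [smul_eq_mul] at h
    linarith)
  rw [inner_neg_left] at this
  unfold breg
  linarith

lemma cmd_breg_eq {E : Type*} [Fintype E] [DecidableEq E]
    (K : Set (EuclideanSpace ℝ (Finset E)))
    (R : EuclideanSpace ℝ (Finset E) → ℝ)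
    (gR : EuclideanSpace ℝ (Finset E) → EuclideanSpace ℝ (Finset E))
    (hc : StrictConvexOn ℝ K R) (u v : EuclideanSpace ℝ (Finset E)) (hu : u ∈ K) (hv : v ∈ K)
    (hg : HasGradientAt R (gR v) v) (h0 : breg R gR u v ≤ 0) : u = v := by
  by_contra hne
  have h1 := hc.2 hu hv hne (by norm_num : (0:ℝ) < 1/2) (by norm_num : (0:ℝ) < 1/2) (by norm_num)
  have hm : (1/2:ℝ) • u + (1/2:ℝ) • v ∈ K :=
    hc.1 hu hv (by norm_num) (by norm_num) (by norm_num)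
  have h2 := cmd_breg_nonneg K R gR hc.convexOn _ v hm hv hg
  unfold breg at h0 h2
  have e : (1/2:ℝ) • u + (1/2:ℝ) • v - v = (1/2:ℝ) • (u - v) := by module
  rw [e, inner_smul_right] at h2
  simp only [smul_eq_mul] at h1
  linarith

lemma cmd_three {n : ℕ} {E : Type*} [Fintype E] [DecidableEq E]
    (S : Fin n → Finset (Finset E)) (i : Fin n)
    (R : EuclideanSpace ℝ (Finset E) → ℝ)
    (gR : EuclideanSpace ℝ (Finset E) → EuclideanSpace ℝ (Finset E))
    (p : Finset E → ℝ) (a : ℝ) (v w z : EuclideanSpace ℝ (Finset E))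
    (hw : w ∈ Ki S i) (hz : z ∈ Ki S i)
    (hg : HasGradientAt R (gR w) w)
    (h : ∀ z ∈ Ki S i, a * ∑ s ∈ S i, p s * w s + breg R gR w v
        ≤ a * ∑ s ∈ S i, p s * z s + breg R gR z v) :
    a * ∑ s ∈ S i, p s * (w s - z s) + breg R gR w v ≤ breg R gR z v - breg R gR z w := by
  have key := cmd_dir R (gR w) w (z - w)
    (⟪gR v, z - w⟫ - a * ∑ s ∈ S i, p s * (z s - w s)) hg (by
    intro t ht0 ht1
    have hm : w + t • (z - w) ∈ Ki S i := by
      have := cmd_Ki_convex S i hw hz (sub_nonneg.2 ht1) ht0.le (by ring)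
      have e : (1 - t) • w + t • z = w + t • (z - w) := by module
      rwa [e] at this
    have h1 := h _ hm
    have e1 : ∑ s ∈ S i, p s * (w + t • (z - w)) s
        = ∑ s ∈ S i, p s * w s + t * ∑ s ∈ S i, p s * (z s - w s) := by
      rw [Finset.mul_sum, ← Finset.sum_add_distrib]
      refine Finset.sum_congr rfl fun s _ => ?_
      simp only [PiLp.add_apply, PiLp.smul_apply, PiLp.sub_apply, smul_eq_mul]
      ring
    rw [e1] at h1
    unfold breg at h1
    have e2 : w + t • (z - w) - v = (w - v) + t • (z - w) := by module
    rw [e2, inner_add_right, inner_smul_right] at h1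
    linarith)
  have e3 : ∑ s ∈ S i, p s * (w s - z s) = - ∑ s ∈ S i, p s * (z s - w s) := by
    rw [← Finset.sum_neg_distrib]
    exact Finset.sum_congr rfl fun s _ => by ring
  have e4 : z - v = (z - w) + (w - v) := by module
  rw [e3]
  unfold breg
  rw [e4, inner_add_right]
  linarith

lemma cmd_load_mem {n : ℕ} (hn : 0 < n) {E : Type*} [Fintype E] [DecidableEq E]
    (S : Fin n → Finset (Finset E)) (x : Fin n → EuclideanSpace ℝ (Finset E))
    (hx : ∀ i, x i ∈ Ki S i) (e : E) : load S x e ∈ Set.Icc (0:ℝ) 1 := by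
  constructor
  · exact Finset.sum_nonneg fun i _ => Finset.sum_nonneg fun s _ => (hx i).1 s
  · have : load S x e ≤ ∑ _i : Fin n, 1 / (n:ℝ) := by
      refine Finset.sum_le_sum fun i _ => ?_
      rw [← (hx i).2.2]
      exact Finset.sum_le_sum_of_subset_of_nonneg (Finset.filter_subset _ _)
        fun s _ _ => (hx i).1 s
    have hn' : (n:ℝ) ≠ 0 := by positivity
    simpa [hn'] using this

lemma cmd_int (c : ℝ → ℝ) (hm : MonotoneOn c (Set.Icc 0 1))
    (a b : ℝ) (ha : a ∈ Set.Icc (0:ℝ) 1) (hb : b ∈ Set.Icc (0:ℝ) 1) :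
    (∫ y in (0:ℝ)..a, c y) + c a * (b - a) ≤ ∫ y in (0:ℝ)..b, c y := by
  have hI : ∀ u ∈ Set.Icc (0:ℝ) 1, ∀ v ∈ Set.Icc (0:ℝ) 1, IntervalIntegrable c volume u v := by
    intro u hu v hv
    exact (hm.mono (Set.uIcc_subset_Icc hu hv)).intervalIntegrable
  have h0 : (0:ℝ) ∈ Set.Icc (0:ℝ) 1 := by simp
  have hadd := intervalIntegral.integral_add_adjacent_intervals (hI 0 h0 a ha) (hI a ha b hb)
  suffices c a * (b - a) ≤ ∫ y in a..b, c y by linarith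
  rcases le_total a b with hab | hab
  · have := intervalIntegral.integral_mono_on hab (intervalIntegrable_const (c := c a))
      (hI a ha b hb) (fun y hy => hm ha ⟨ha.1.trans hy.1, hy.2.trans hb.2⟩ hy.1)
    simp only [intervalIntegral.integral_const, smul_eq_mul] at this
    linarith
  · have := intervalIntegral.integral_mono_on hab (hI b hb a ha)
      (intervalIntegrable_const (c := c a))
      (fun y hy => hm ⟨hb.1.trans hy.1, hy.2.trans ha.2⟩ ha hy.2)
    simp only [intervalIntegral.integral_const, smul_eq_mul] at this
    rw [intervalIntegral.integral_symm]
    linarith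

lemma cmd_conv {n : ℕ} (hn : 0 < n) {E : Type*} [Fintype E] [DecidableEq E]
    (S : Fin n → Finset (Finset E)) (c : E → ℝ → ℝ)
    (hmono : ∀ e, MonotoneOn (c e) (Set.Icc 0 1))
    (x y : Fin n → EuclideanSpace ℝ (Finset E))
    (hx : ∀ i, x i ∈ Ki S i) (hy : ∀ i, y i ∈ Ki S i) :
    potential S c x + ∑ i, ∑ s ∈ S i, pathCost S c x s * (y i s - x i s) ≤ potential S c y := by
  have e1 : ∑ i, ∑ s ∈ S i, pathCost S c x s * (y i s - x i s)
      = ∑ e, c e (load S x e) * (load S y e - load S x e) := by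
    have h1 : ∀ e, c e (load S x e) * (load S y e - load S x e)
        = ∑ i, ∑ s ∈ S i, if e ∈ s then c e (load S x e) * (y i s - x i s) else 0 := by
      intro e
      conv_lhs => arg 2; unfold load
      rw [← Finset.sum_sub_distrib, Finset.mul_sum]
      refine Finset.sum_congr rfl fun i _ => ?_
      rw [← Finset.sum_sub_distrib, Finset.mul_sum, Finset.sum_filter]
    simp_rw [h1]
    rw [Finset.sum_comm]
    refine Finset.sum_congr rfl fun i _ => ?_
    rw [Finset.sum_comm]
    refine Finset.sum_congr rfl fun s _ => ?_
    unfold pathCost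
    rw [Finset.sum_mul, ← Finset.sum_filter]
    refine Finset.sum_congr (by ext; simp) fun _ _ => rfl
  rw [e1]
  unfold potential
  rw [← Finset.sum_add_distrib]
  exact Finset.sum_le_sum fun e _ => cmd_int (c e) (hmono e) _ _
    (cmd_load_mem hn S x hx e) (cmd_load_mem hn S y hy e)

/-- convergence of mirror-descent dynamics in nonatomic congestion games.
With nondecreasing edge costs (so `Φ` is convex), `Φ` `λ`-smooth with respect to
differentiable strictly convex regularizers `(R₁,…,R_n)`, `q` a minimizer of `Φ` over `𝒦`,
initial strategies with `B^{R_i}(q_i, x⁰_i) ≤ γ`, and mirror-descent updates driven by the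
path-cost vectors with step sizes `η ≤ η_i ≤ 1/λ`, one has `Φ(x^t) ≤ Φ(q) + ε` for every
`ε ∈ (0,1)` and every `t ≥ nγ/(ηε)`. -/
theorem congestion_mirror_descent_converges
    {n : ℕ} (hn : 0 < n) {E : Type*} [Fintype E] [DecidableEq E]
    (S : Fin n → Finset (Finset E))
    (hSne : ∀ i, (S i).Nonempty)
    (hpaths : ∀ i, ∀ s ∈ S i, s.Nonempty)
    (c : E → ℝ → ℝ)
    (hmono : ∀ e, MonotoneOn (c e) (Set.Icc 0 1))
    (hint : ∀ e, IntervalIntegrable (c e) volume 0 1)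
    (R : (i : Fin n) → EuclideanSpace ℝ (Finset E) → ℝ)
    (gR : (i : Fin n) → EuclideanSpace ℝ (Finset E) → EuclideanSpace ℝ (Finset E))
    (hRgradAt : ∀ i, ∀ v ∈ Ki S i, HasGradientAt (R i) (gR i v) v)
    (hRstrict : ∀ i, StrictConvexOn ℝ (Ki S i) (R i))
    (lam γ η : ℝ) (hlam : 0 < lam) (hη : 0 < η) (hγ : 0 ≤ γ)
    (hsmooth : ∀ x y : Fin n → EuclideanSpace ℝ (Finset E),
      (∀ i, x i ∈ Ki S i) → (∀ i, y i ∈ Ki S i) →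
      potential S c y ≤ potential S c x
        + ∑ i, ∑ s ∈ S i, pathCost S c x s * (y i s - x i s)
        + lam * ∑ i, breg (R i) (gR i) (y i) (x i))
    (q : Fin n → EuclideanSpace ℝ (Finset E))
    (hqK : ∀ i, q i ∈ Ki S i)
    (hqmin : ∀ z : Fin n → EuclideanSpace ℝ (Finset E),
      (∀ i, z i ∈ Ki S i) → potential S c q ≤ potential S c z)
    (x : ℕ → Fin n → EuclideanSpace ℝ (Finset E))
    (hx0K : ∀ i, x 0 i ∈ Ki S i)
    (hx0γ : ∀ i, breg (R i) (gR i) (q i) (x 0 i) ≤ γ)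
    (eta : Fin n → ℝ) (heta1 : ∀ i, η ≤ eta i) (heta2 : ∀ i, eta i ≤ 1 / lam)
    (hupdate : ∀ t i, x (t + 1) i ∈ Ki S i ∧ ∀ z ∈ Ki S i,
      eta i * ∑ s ∈ S i, pathCost S c (x t) s * x (t + 1) i s
          + breg (R i) (gR i) (x (t + 1) i) (x t i)
        ≤ eta i * ∑ s ∈ S i, pathCost S c (x t) s * z s
          + breg (R i) (gR i) z (x t i)) :
    ∀ ε ∈ Set.Ioo (0:ℝ) 1, ∀ t : ℕ, (n : ℝ) * γ / (η * ε) ≤ t →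
      potential S c (x t) ≤ potential S c q + ε := by
  have hxK : ∀ t i, x t i ∈ Ki S i := by
    intro t
    cases t with
    | zero => exact hx0K
    | succ t => exact fun i => (hupdate t i).1
  have hpos : ∀ i, 0 < eta i := fun i => hη.trans_le (heta1 i)
  have hB : ∀ i, ∀ u ∈ Ki S i, ∀ v ∈ Ki S i, 0 ≤ breg (R i) (gR i) u v := fun i u hu v hv =>
    cmd_breg_nonneg _ _ _ (hRstrict i).convexOn u v hu hv (hRgradAt i v hv)
  have step : ∀ t, ∀ z : Fin n → EuclideanSpace ℝ (Finset E), (∀ i, z i ∈ Ki S i) →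
      potential S c (x (t+1)) ≤ potential S c (x t)
        + ∑ i, ∑ s ∈ S i, pathCost S c (x t) s * (z i s - x t i s)
        + ∑ i, (breg (R i) (gR i) (z i) (x t i) - breg (R i) (gR i) (z i) (x (t+1) i)) / eta i := by
    intro t z hz
    refine (hsmooth (x t) (x (t+1)) (hxK t) (hxK (t+1))).trans ?_
    rw [Finset.mul_sum, add_assoc, add_assoc, ← Finset.sum_add_distrib, ← Finset.sum_add_distrib]
    refine add_le_add le_rfl (Finset.sum_le_sum fun i _ => ?_)
    have h3 := cmd_three S i (R i) (gR i) (pathCost S c (x t)) (eta i) (x t i) (x (t+1) i) (z i)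
      (hxK (t+1) i) (hz i) (hRgradAt i _ (hxK (t+1) i)) (hupdate t i).2
    have hb := hB i _ (hxK (t+1) i) _ (hxK t i)
    have hl : lam * eta i ≤ 1 := by
      have := heta2 i
      rw [le_div_iff₀ hlam] at this
      linarith
    have e : ∑ s ∈ S i, pathCost S c (x t) s * (x (t+1) i s - x t i s)
        = ∑ s ∈ S i, pathCost S c (x t) s * (x (t+1) i s - z i s)
          + ∑ s ∈ S i, pathCost S c (x t) s * (z i s - x t i s) := by
      rw [← Finset.sum_add_distrib]
      exact Finset.sum_congr rfl fun s _ => by ring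
    rw [e]
    suffices ∑ s ∈ S i, pathCost S c (x t) s * (x (t+1) i s - z i s)
        + lam * breg (R i) (gR i) (x (t+1) i) (x t i) ≤
        (breg (R i) (gR i) (z i) (x t i) - breg (R i) (gR i) (z i) (x (t+1) i)) / eta i by linarith
    rw [le_div_iff₀ (hpos i)]
    nlinarith [mul_le_mul_of_nonneg_right hl hb]
  have hself : ∀ i v, breg (R i) (gR i) v v = 0 := by
    intro i v
    simp [breg]
  have desc : ∀ t, potential S c (x (t+1)) ≤ potential S c (x t) := by
    intro t
    have h := step t (x t) (hxK t)
    simp only [sub_self, mul_zero, Finset.sum_const_zero, add_zero, hself, zero_sub] at h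
    have : ∑ i, (-breg (R i) (gR i) (x t i) (x (t+1) i)) / eta i ≤ 0 :=
      Finset.sum_nonpos fun i _ => div_nonpos_of_nonpos_of_nonneg
        (neg_nonpos.2 (hB i _ (hxK t i) _ (hxK (t+1) i))) (hpos i).le
    linarith
  have tel : ∀ t : ℕ, (t:ℝ) * (potential S c (x t) - potential S c q)
      + ∑ i, breg (R i) (gR i) (q i) (x t i) / eta i
      ≤ ∑ i, breg (R i) (gR i) (q i) (x 0 i) / eta i := by
    intro t
    induction t with
    | zero => simp
    | succ t ih =>
      have h := step t q hqK
      have hc := cmd_conv hn S c hmono (x t) q (hxK t) hqK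
      simp only [sub_div, Finset.sum_sub_distrib] at h
      have hd := mul_le_mul_of_nonneg_left (desc t) (Nat.cast_nonneg (α := ℝ) t)
      push_cast
      linarith
  intro ε hε t ht
  have hε0 := hε.1
  rw [div_le_iff₀ (by positivity)] at ht
  rcases Nat.eq_zero_or_pos t with rfl | htpos
  · have hn' : (0:ℝ) < n := by exact_mod_cast hn
    have hγ0 : γ ≤ 0 := by
      by_contra hcon
      push Not at hcon
      have := mul_pos hn' hcon
      simp at ht
      linarith
    have : x 0 = q := by
      funext i
      exact (cmd_breg_eq (Ki S i) (R i) (gR i) (hRstrict i) _ _ (hqK i) (hx0K i)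
        (hRgradAt i _ (hx0K i)) ((hx0γ i).trans hγ0)).symm
    rw [this]
    linarith
  · have h1 : ∑ i, breg (R i) (gR i) (q i) (x 0 i) / eta i ≤ n * (γ / η) := by
      have : ∑ i, breg (R i) (gR i) (q i) (x 0 i) / eta i ≤ ∑ _i : Fin n, γ / η :=
        Finset.sum_le_sum fun i _ => div_le_div₀ hγ (hx0γ i) hη (heta1 i)
      simpa using this
    have h2 : 0 ≤ ∑ i, breg (R i) (gR i) (q i) (x t i) / eta i :=
      Finset.sum_nonneg fun i _ => div_nonneg (hB i _ (hqK i) _ (hxK t i)) (hpos i).le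
    have h3 : n * (γ / η) ≤ t * ε := by
      rw [← mul_div_assoc, div_le_iff₀ hη]
      linarith
    have h4 : (t:ℝ) * (potential S c (x t) - potential S c q) ≤ t * ε := by
      linarith [tel t]
    have := le_of_mul_le_mul_left h4 (by exact_mod_cast htpos)
    linarith
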